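/- arXiv:2001.11959 — 2 statements merged into one kernel-verified Lean document; each statement's English description precedes it below -/
import Mathlib

section
/- For every real number λ ≥ 21, the number of prime numbers p satisfying λ ≤ p ≤ 2λ is at least (3/5)·λ/ln(λ). -/
/-- The number of integers in `[b, b + k)` coprime to `M`, in a form that evaluates quickly. -/
def coprimeCount (M b : ℕ) : ℕ → ℕ
  | 0 => 0
  | k + 1 => coprimeCount M b k + (Nat.gcd (b + k) M == 1).toNat

theorem coprimeCount_eq_card (M b k : ℕ) :
    coprimeCount M b k = ((Finset.Ico b (b + k)).filter (Nat.Coprime · M)).card := by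
  induction k with
  | zero => simp [coprimeCount]
  | succ k ih =>
    rw [coprimeCount, ih, ← add_assoc, ← Finset.insert_Ico_right_eq_Ico_add_one (by omega),
      Finset.filter_insert]
    by_cases h : Nat.Coprime (b + k) M
    · rw [if_pos h, Finset.card_insert_of_notMem (by simp)]
      simp [Nat.coprime_iff_gcd_eq_one.mp h]
    · rw [if_neg h]
      have : (Nat.gcd (b + k) M == 1) = false := by simpa [Nat.Coprime] using h
      simp [this]

theorem Nat.prime_of_coprime_factorial {n B : ℕ} (hn : 1 < n) (hB : n < (B + 1) ^ 2)
    (h : n.Coprime B.factorial) : n.Prime := by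
  by_contra hp
  have h1 : n.minFac ^ 2 ≤ n := Nat.minFac_sq_le_self (by omega) hp
  have h2 : n.minFac ≤ B := by
    have := lt_of_pow_lt_pow_left₀ 2 (by omega) (h1.trans_lt hB)
    omega
  exact Nat.not_coprime_of_dvd_of_dvd (Nat.minFac_prime hn.ne').one_lt n.minFac_dvd
    (Nat.dvd_factorial n.minFac_pos h2) h

/-- A decidable certificate for the prime count on `[x, 2 * x]` for all `x` between consecutive
elements of the list, where `M` is meant to be `B !`. -/
def primeCountCert (B M : ℕ) : List ℕ → Bool
  | a :: b :: l =>
    (decide (21 ≤ a ∧ a ≤ b ∧ 2 * a < (B + 1) ^ 2 ∧ 3 * b * 160000 ≤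
      5 * coprimeCount M b (2 * a + 1 - b) * Nat.log2 (b ^ 16) * 6931)) &&
      primeCountCert B M (b :: l)
  | _ => true

theorem log2_pow_mul_le_log {b : ℕ} (hb : 0 < b) :
    (Nat.log2 (b ^ 16) : ℝ) * 6931 / 160000 ≤ Real.log b := by
  have h1 : ((2 ^ Nat.log2 (b ^ 16) : ℕ) : ℝ) ≤ ((b ^ 16 : ℕ) : ℝ) := by
    exact_mod_cast Nat.log2_self_le (by positivity)
  have h2 := Real.log_le_log (by positivity) h1
  push_cast at h2
  rw [Real.log_pow, Real.log_pow] at h2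
  have h3 : (0 : ℝ) ≤ (Nat.log2 (b ^ 16) : ℝ) := by positivity
  push_cast at h2
  nlinarith [mul_nonneg h3 (sub_nonneg.mpr Real.log_two_gt_d9.le)]

theorem prime_count_of_interval {B a b : ℕ} {x : ℝ} (ha : 21 ≤ a) (hB : 2 * a < (B + 1) ^ 2)
    (h : 3 * b * 160000 ≤
      5 * coprimeCount B.factorial b (2 * a + 1 - b) * Nat.log2 (b ^ 16) * 6931)
    (hax : a ≤ x) (hxb : x ≤ b) :
    (3 / 5) * x / Real.log x ≤
      (((Finset.Icc ⌈x⌉₊ ⌊2 * x⌋₊).filter Nat.Prime).card : ℝ) := by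
  have ha' : (21 : ℝ) ≤ a := by exact_mod_cast ha
  have hb : 21 ≤ b := by
    have : (21 : ℝ) ≤ b := by linarith
    exact_mod_cast this
  have hcard : coprimeCount B.factorial b (2 * a + 1 - b) ≤
      ((Finset.Icc ⌈x⌉₊ ⌊2 * x⌋₊).filter Nat.Prime).card := by
    rw [coprimeCount_eq_card]
    refine Finset.card_le_card fun p hp ↦ ?_
    simp only [Finset.mem_filter, Finset.mem_Ico, Finset.mem_Icc] at hp ⊢
    refine ⟨⟨(Nat.ceil_le.mpr hxb).trans hp.1.1, Nat.le_floor ?_⟩,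
      Nat.prime_of_coprime_factorial (B := B) (by omega) (by omega) hp.2⟩
    have : (p : ℝ) ≤ 2 * a := by exact_mod_cast (by omega : p ≤ 2 * a)
    linarith
  have he : Real.exp 1 ≤ x := by linarith [Real.exp_one_lt_d9]
  have hmono : Real.log b / b ≤ Real.log x / x :=
    Real.log_div_self_antitoneOn he (he.trans hxb) hxb
  have hx : 0 ≤ x := by linarith
  have hlog : 0 < Real.log x := Real.log_pos (by linarith)
  rw [div_le_div_iff₀ (by linarith) (by linarith)] at hmono
  rw [div_le_iff₀ hlog]
  set c := ((Finset.Icc ⌈x⌉₊ ⌊2 * x⌋₊).filter Nat.Prime).card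
  have h' : (3 : ℝ) * b * 160000 ≤ 5 * c * Nat.log2 (b ^ 16) * 6931 := by
    have : 3 * b * 160000 ≤ 5 * c * Nat.log2 (b ^ 16) * 6931 := h.trans (by gcongr)
    exact_mod_cast this
  have hb0 : (0 : ℝ) < b := by linarith
  have hl := log2_pow_mul_le_log (b := b) (by omega)
  have hcb : 3 / 5 * (b : ℝ) ≤ c * Real.log b := by
    have := mul_le_mul_of_nonneg_left hl (Nat.cast_nonneg (α := ℝ) c)
    linarith
  refine le_of_mul_le_mul_right ?_ hb0
  calc 3 / 5 * x * b = 3 / 5 * b * x := by ring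
    _ ≤ c * Real.log b * x := by gcongr
    _ = c * (Real.log b * x) := by ring
    _ ≤ c * (Real.log x * b) := by gcongr
    _ = c * Real.log x * b := by ring

theorem prime_count_of_cert {B a : ℕ} {l : List ℕ}
    (h : primeCountCert B B.factorial (a :: l) = true) {x : ℝ} (hax : a ≤ x)
    (hx : x < (a :: l).getLast (by simp)) :
    (3 / 5) * x / Real.log x ≤
      (((Finset.Icc ⌈x⌉₊ ⌊2 * x⌋₊).filter Nat.Prime).card : ℝ) := by
  induction l generalizing a with
  | nil => simp at hx; linarith
  | cons b l ih =>
    simp only [primeCountCert, Bool.and_eq_true, decide_eq_true_eq] at h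
    rcases le_total x b with hb | hb
    · exact prime_count_of_interval h.1.1 h.1.2.2.1 h.1.2.2.2 hax hb
    · exact ih h.2 hb (by simpa using hx)

theorem prime_count_of_lt_five_thousand {x : ℝ} (h21 : 21 ≤ x) (hx : x < 5000) :
    (3 / 5) * x / Real.log x ≤
      (((Finset.Icc ⌈x⌉₊ ⌊2 * x⌋₊).filter Nat.Prime).card : ℝ) := by
  rcases lt_or_ge x 220 with h | h
  · have hc : primeCountCert 20 (Nat.factorial 20)
      [21, 23, 27, 31, 37, 43, 52, 61, 71, 83, 99, 119, 139, 170, 199, 220] = true := by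
      decide +kernel
    exact prime_count_of_cert hc (by simpa using h21) (by simpa using h)
  · have hc : primeCountCert 100 (Nat.factorial 100)
      [220, 269, 317, 385, 467, 569, 697, 839, 1033, 1259, 1537, 1884, 2313, 2827, 3488, 4289,
        5000] = true := by
      decide +kernel
    exact prime_count_of_cert hc (by simpa using h) (by simpa using hx)

theorem log_factorial_eq_sum_vonMangoldt (n : ℕ) :
    Real.log n.factorial = ∑ d ∈ Finset.Ioc 0 n, ArithmeticFunction.vonMangoldt d * (n / d : ℕ) := by
  rw [← ArithmeticFunction.sum_Ioc_mul_zeta_eq_sum, ArithmeticFunction.vonMangoldt_mul_zeta]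
  induction n with
  | zero => simp
  | succ n ih =>
    rw [← Finset.insert_Ioc_right_eq_Ioc_add_one (by omega), Finset.sum_insert (by simp), ← ih,
      Nat.factorial_succ, Nat.cast_mul, Real.log_mul (by positivity) (by positivity)]
    simp

theorem log_factorial_div_eq_sum_vonMangoldt (n k : ℕ) :
    Real.log (n / k).factorial =
      ∑ d ∈ Finset.Ioc 0 n, ArithmeticFunction.vonMangoldt d * (n / d / k : ℕ) := by
  rw [log_factorial_eq_sum_vonMangoldt]
  refine Finset.sum_subset_zero_on_sdiff
    (Finset.Ioc_subset_Ioc_right (Nat.div_le_self n k)) (fun d hd ↦ ?_) fun d hd ↦ ?_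
  · simp only [Finset.mem_sdiff, Finset.mem_Ioc, not_and, not_le] at hd
    rw [Nat.div_div_eq_div_mul, mul_comm d k, ← Nat.div_div_eq_div_mul,
      Nat.div_eq_of_lt (hd.2 hd.1.1)]
    simp
  · rw [Nat.div_div_eq_div_mul, Nat.div_div_eq_div_mul, mul_comm k d]

/-- Chebyshev's alternating combination of logarithms of factorials. -/
noncomputable def chebyshevAlpha (n : ℕ) : ℝ :=
  Real.log n.factorial - Real.log (n / 2).factorial - Real.log (n / 3).factorial -
    Real.log (n / 5).factorial + Real.log (n / 30).factorial

theorem chebyshevAlpha_eq_sum (n : ℕ) :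
    chebyshevAlpha n = ∑ d ∈ Finset.Ioc 0 n, ArithmeticFunction.vonMangoldt d *
      (((n / d : ℕ) : ℝ) - (n / d / 2 : ℕ) - (n / d / 3 : ℕ) - (n / d / 5 : ℕ) +
        (n / d / 30 : ℕ)) := by
  simp only [chebyshevAlpha, log_factorial_div_eq_sum_vonMangoldt]
  rw [log_factorial_eq_sum_vonMangoldt, ← Finset.sum_sub_distrib, ← Finset.sum_sub_distrib,
    ← Finset.sum_sub_distrib, ← Finset.sum_add_distrib]
  exact Finset.sum_congr rfl fun d _ ↦ by ring

theorem chebyshevAlpha_le_psi (n : ℕ) : chebyshevAlpha n ≤ Chebyshev.psi n := by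
  rw [chebyshevAlpha_eq_sum, Chebyshev.psi, Nat.floor_natCast]
  refine Finset.sum_le_sum fun d _ ↦
    mul_le_of_le_one_right ArithmeticFunction.vonMangoldt_nonneg ?_
  have : n / d + n / d / 30 ≤ 1 + n / d / 2 + n / d / 3 + n / d / 5 := by omega
  have : ((n / d : ℕ) : ℝ) + (n / d / 30 : ℕ) ≤
      1 + (n / d / 2 : ℕ) + (n / d / 3 : ℕ) + (n / d / 5 : ℕ) := by exact_mod_cast this
  linarith

theorem psi_le_chebyshevAlpha_add (n : ℕ) :
    Chebyshev.psi n ≤ chebyshevAlpha n + Chebyshev.psi (n / 6 : ℕ) := by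
  rw [chebyshevAlpha_eq_sum, Chebyshev.psi, Chebyshev.psi, Nat.floor_natCast, Nat.floor_natCast,
    ← Finset.sum_Ioc_consecutive _ (Nat.zero_le _) (Nat.div_le_self n 6),
    ← Finset.sum_Ioc_consecutive _ (Nat.zero_le _) (Nat.div_le_self n 6), add_comm]
  have key (m : ℕ) : (0 : ℝ) ≤ (m : ℝ) - (m / 2 : ℕ) - (m / 3 : ℕ) - (m / 5 : ℕ) + (m / 30 : ℕ) := by
    have : m / 2 + m / 3 + m / 5 ≤ m + m / 30 := by omega
    have : ((m / 2 : ℕ) : ℝ) + (m / 3 : ℕ) + (m / 5 : ℕ) ≤ m + (m / 30 : ℕ) := by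
      exact_mod_cast this
    linarith
  have h1 : ∑ d ∈ Finset.Ioc (n / 6) n, ArithmeticFunction.vonMangoldt d ≤
      ∑ d ∈ Finset.Ioc (n / 6) n, ArithmeticFunction.vonMangoldt d *
      (((n / d : ℕ) : ℝ) - (n / d / 2 : ℕ) - (n / d / 3 : ℕ) - (n / d / 5 : ℕ) +
        (n / d / 30 : ℕ)) := by
    refine Finset.sum_le_sum fun d hd ↦ ?_
    simp only [Finset.mem_Ioc] at hd
    have hlt : n / d < 6 := by
      rw [Nat.div_lt_iff_lt_mul (by omega)]
      omega
    have hpos : 0 < n / d := Nat.div_pos hd.2 (by omega)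
    generalize n / d = m at hlt hpos
    interval_cases m <;> norm_num
  have h2 := Finset.sum_nonneg (s := Finset.Ioc 0 (n / 6)) fun d _ ↦
    mul_nonneg (ArithmeticFunction.vonMangoldt_nonneg (n := d)) (key (n / d))
  linarith

theorem log_factorial_floor_le {x : ℝ} (hx : 1 ≤ x) :
    Real.log (⌊x⌋₊).factorial ≤ x * Real.log x - x + Real.log x / 2 + 1 := by
  obtain ⟨m, hm⟩ : ∃ m, ⌊x⌋₊ = m + 1 :=
    Nat.exists_eq_succ_of_ne_zero (Nat.floor_pos.mpr hx).ne'
  have hmx : ((m + 1 : ℕ) : ℝ) ≤ x := hm ▸ Nat.floor_le (by linarith)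
  rw [hm]
  have h1 : Real.log (Stirling.stirlingSeq (m + 1)) ≤ Real.log (Stirling.stirlingSeq 1) :=
    Stirling.log_stirlingSeq'_antitone (Nat.zero_le m)
  rw [Stirling.log_stirlingSeq_formula, Stirling.log_stirlingSeq_formula,
    Real.log_div (by positivity) (by positivity), Real.log_div (by positivity) (by positivity),
    Real.log_mul (by positivity) (by positivity), Real.log_mul (by positivity) (by positivity)] at h1
  simp only [Real.log_exp, Nat.factorial_one, Nat.cast_one, Real.log_one] at h1
  set N : ℝ := ((m + 1 : ℕ) : ℝ)
  have hN : 1 ≤ N := by simp [N]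
  have hlog : Real.log N ≤ Real.log x := Real.log_le_log (by linarith) hmx
  have hlog0 : 0 ≤ Real.log N := Real.log_nonneg hN
  have h2 : 1 - (x / N)⁻¹ ≤ Real.log (x / N) := Real.one_sub_inv_le_log_of_pos (by positivity)
  rw [Real.log_div (by positivity) (by positivity), inv_div] at h2
  have h3 : x - N ≤ x * (Real.log x - Real.log N) := by
    have := mul_le_mul_of_nonneg_left h2 (by linarith : 0 ≤ x)
    have e : x * (1 - N / x) = x - N := by field_simp
    linarith
  nlinarith [mul_nonneg (sub_nonneg.mpr hmx) hlog0]

theorem le_log_factorial_floor {x : ℝ} (hx : 1 ≤ x) :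
    x * Real.log x - x - Real.log x + 9 / 10 ≤ Real.log (⌊x⌋₊).factorial := by
  have hN0 : ⌊x⌋₊ ≠ 0 := (Nat.floor_pos.mpr hx).ne'
  have h1 := Stirling.le_log_factorial_stirling hN0
  have hNx : (⌊x⌋₊ : ℝ) ≤ x := Nat.floor_le (by linarith)
  have hxN : x < ⌊x⌋₊ + 1 := Nat.lt_floor_add_one x
  have hN : (1 : ℝ) ≤ ⌊x⌋₊ := by exact_mod_cast Nat.one_le_iff_ne_zero.mpr hN0
  set N : ℝ := (⌊x⌋₊ : ℝ)
  have hlogN : 0 ≤ Real.log N := Real.log_nonneg hN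
  have hlogx : 0 ≤ Real.log x := Real.log_nonneg hx
  have hpi : 9 / 5 ≤ Real.log (2 * Real.pi) := by
    rw [Real.le_log_iff_exp_le (by positivity)]
    have h5 : Real.exp (9 / 5) ^ 5 = Real.exp 1 ^ 9 := by
      rw [← Real.exp_nat_mul, ← Real.exp_nat_mul]; norm_num
    have h6 : Real.exp 1 ^ 9 ≤ 2.7182818286 ^ 9 :=
      pow_le_pow_left₀ (by positivity) Real.exp_one_lt_d9.le 9
    have h7 : Real.exp (9 / 5) ≤ 6.28 := by
      refine le_of_pow_le_pow_left₀ (n := 5) (by norm_num) (by norm_num) ?_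
      rw [h5]
      exact h6.trans (by norm_num)
    linarith [Real.pi_gt_d2]
  have h2 : 1 - (N / x)⁻¹ ≤ Real.log (N / x) := Real.one_sub_inv_le_log_of_pos (by positivity)
  rw [Real.log_div (by positivity) (by positivity), inv_div] at h2
  have h3 : N - x ≤ N * (Real.log N - Real.log x) := by
    have := mul_le_mul_of_nonneg_left h2 (by linarith : 0 ≤ N)
    have e : N * (1 - x / N) = N - x := by field_simp
    linarith
  nlinarith [mul_nonneg (by linarith : 0 ≤ N + 1 - x) hlogx]

theorem abs_chebyshevAlpha_floor_sub_le {x : ℝ} (hx : 30 ≤ x) :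
    |chebyshevAlpha ⌊x⌋₊ - x * ((14 * Real.log 2 + 9 * Real.log 3 + 5 * Real.log 5) / 30)| ≤
      4 * Real.log x := by
  have hfl (k : ℕ) : ⌊x⌋₊ / k = ⌊x / k⌋₊ := (Nat.floor_div_natCast x k).symm
  have hd (k : ℕ) (hk : 0 < k) : Real.log (x / k) = Real.log x - Real.log k :=
    Real.log_div (by positivity) (by positivity)
  have l1 := le_log_factorial_floor (x := x) (by linarith)
  have u1 := log_factorial_floor_le (x := x) (by linarith)
  have l2 := le_log_factorial_floor (x := x / (2 : ℕ)) (by push_cast; linarith)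
  have u2 := log_factorial_floor_le (x := x / (2 : ℕ)) (by push_cast; linarith)
  have l3 := le_log_factorial_floor (x := x / (3 : ℕ)) (by push_cast; linarith)
  have u3 := log_factorial_floor_le (x := x / (3 : ℕ)) (by push_cast; linarith)
  have l5 := le_log_factorial_floor (x := x / (5 : ℕ)) (by push_cast; linarith)
  have u5 := log_factorial_floor_le (x := x / (5 : ℕ)) (by push_cast; linarith)
  have l30 := le_log_factorial_floor (x := x / (30 : ℕ)) (by push_cast; linarith)
  have u30 := log_factorial_floor_le (x := x / (30 : ℕ)) (by push_cast; linarith)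
  have e30 : Real.log 30 = Real.log 2 + Real.log 3 + Real.log 5 := by
    rw [← Real.log_mul (by norm_num) (by norm_num), ← Real.log_mul (by norm_num) (by norm_num)]
    norm_num
  have hx30 : Real.log 30 ≤ Real.log x := Real.log_le_log (by norm_num) hx
  rw [hd _ (by norm_num)] at l2 u2 l3 u3 l5 u5 l30 u30
  push_cast at l2 u2 l3 u3 l5 u5 l30 u30
  rw [e30] at l30 u30 hx30
  simp only [chebyshevAlpha, hfl]
  push_cast
  rw [abs_le]
  have b2 := Real.log_two_gt_d9
  have b3 := Real.log_three_gt_d9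
  have b5 := Real.log_five_gt_d9
  constructor <;> nlinarith

theorem psi_ge_of_thirty_le {x : ℝ} (hx : 30 ≤ x) :
    921 / 1000 * x - 4 * Real.log x ≤ Chebyshev.psi x := by
  have h := (abs_le.mp (abs_chebyshevAlpha_floor_sub_le hx)).1
  have h2 := chebyshevAlpha_le_psi ⌊x⌋₊
  rw [← Chebyshev.psi_eq_psi_coe_floor] at h2
  nlinarith [Real.log_two_gt_d9, Real.log_three_gt_d9, Real.log_five_gt_d9]

theorem psi_le_add_psi_div_six {x : ℝ} (hx : 30 ≤ x) :
    Chebyshev.psi x ≤ 922 / 1000 * x + 4 * Real.log x + Chebyshev.psi (x / 6) := by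
  have h := (abs_le.mp (abs_chebyshevAlpha_floor_sub_le hx)).2
  have h2 := psi_le_chebyshevAlpha_add ⌊x⌋₊
  have e : ⌊x⌋₊ / 6 = ⌊x / 6⌋₊ := by simpa using (Nat.floor_div_natCast x 6).symm
  rw [e, ← Chebyshev.psi_eq_psi_coe_floor, ← Chebyshev.psi_eq_psi_coe_floor] at h2
  nlinarith [Real.log_two_lt_d9, Real.log_three_lt_d9, Real.log_five_lt_d9]

/-- Tests `lcm (1, …, m) ≤ 3 ^ m` for all `m` from `n` to `n + k`, where `L` is the value of the
least common multiple at `n`. -/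
def lcmUptoCert : ℕ → ℕ → ℕ → Bool
  | 0, n, L => decide (L ≤ 3 ^ n)
  | k + 1, n, L => decide (L ≤ 3 ^ n) && lcmUptoCert k (n + 1) (Nat.lcm (n + 1) L)

theorem lcmUpto_le_three_pow_of_cert {k n : ℕ} (h : lcmUptoCert k n (Nat.lcmUpto n) = true)
    {m : ℕ} (hnm : n ≤ m) (hm : m ≤ n + k) : Nat.lcmUpto m ≤ 3 ^ m := by
  induction k generalizing n with
  | zero =>
    obtain rfl : m = n := by omega
    simpa [lcmUptoCert] using h
  | succ k ih =>
    simp only [lcmUptoCert, Bool.and_eq_true, decide_eq_true_eq] at h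
    rcases hnm.eq_or_lt with rfl | hlt
    · exact h.1
    · refine ih ?_ hlt (by omega)
      have : Nat.lcmUpto (n + 1) = Nat.lcm (n + 1) (Nat.lcmUpto n) := by
        rw [Nat.lcmUpto, ← Finset.insert_Icc_right_eq_Icc_add_one (by omega), Finset.lcm_insert]
        rfl
      rw [this]
      exact h.2

theorem lcmUpto_le_three_pow {n : ℕ} (hn : n ≤ 400) : Nat.lcmUpto n ≤ 3 ^ n := by
  have h0 : Nat.lcmUpto 0 = 1 := by simp [Nat.lcmUpto]
  have hcert : lcmUptoCert 400 0 1 = true := by decide +kernel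
  exact lcmUpto_le_three_pow_of_cert (h0.symm ▸ hcert) (Nat.zero_le n) (by omega)

theorem psi_le_of_nonneg {x : ℝ} (hx : 0 ≤ x) : Chebyshev.psi x ≤ 6 / 5 * x := by
  induction hn : ⌊x⌋₊ using Nat.strong_induction_on generalizing x with
  | _ n ih =>
    have hfloor : (⌊x⌋₊ : ℝ) ≤ x := Nat.floor_le hx
    rcases le_or_gt n 400 with h | h
    · have hl := lcmUpto_le_three_pow h
      rw [Chebyshev.psi_eq_psi_coe_floor, hn, Chebyshev.psi_eq_log_lcmUpto]
      have h1 : Real.log (Nat.lcmUpto n) ≤ Real.log ((3 : ℝ) ^ n) :=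
        Real.log_le_log (by exact_mod_cast Nat.lcmUpto_pos n) (by exact_mod_cast hl)
      rw [Real.log_pow] at h1
      rw [hn] at hfloor
      nlinarith [Real.log_three_lt_d9, Nat.cast_nonneg (α := ℝ) n]
    · have hx400 : 400 ≤ x := by
        rw [← hn] at h
        exact (by exact_mod_cast h.le : (400 : ℝ) ≤ ⌊x⌋₊).trans hfloor
      have hlt : ⌊x / 6⌋₊ < n := by
        rw [← hn, Nat.floor_lt (by positivity)]
        linarith [Nat.lt_floor_add_one x]
      have h6 := ih _ hlt (x := x / 6) (by positivity) rfl
      have h1 := psi_le_add_psi_div_six (x := x) (by linarith)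
      have h2 : Real.log (x / 400) ≤ x / 400 - 1 := Real.log_le_sub_one_of_pos (by positivity)
      have h3 : Real.log 400 ≤ 6.1 := by
        have : Real.log 400 = 4 * Real.log 2 + 2 * Real.log 5 := by
          rw [show (400 : ℝ) = 2 ^ 4 * 5 ^ 2 by norm_num,
            Real.log_mul (by norm_num) (by norm_num), Real.log_pow, Real.log_pow]
          norm_num
        linarith [Real.log_two_lt_d9, Real.log_five_lt_d9]
      rw [Real.log_div (by positivity) (by norm_num)] at h2
      linarith

theorem psi_sub_theta_le_of_le {y : ℝ} (hy : 10000 ≤ y) :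
    Chebyshev.psi y - Chebyshev.theta y ≤ 9 / 5 * √y := by
  have hy0 : 0 ≤ y := by linarith
  have h := Chebyshev.psi_sub_theta_le_psi_add_psi_add_psi y
  have h2 := psi_le_of_nonneg (Real.rpow_nonneg hy0 (2 : ℝ)⁻¹)
  have h3 := psi_le_of_nonneg (Real.rpow_nonneg hy0 (3 : ℝ)⁻¹)
  have h5 := psi_le_of_nonneg (Real.rpow_nonneg hy0 (5 : ℝ)⁻¹)
  have h53 : y ^ (5 : ℝ)⁻¹ ≤ y ^ (3 : ℝ)⁻¹ :=
    Real.rpow_le_rpow_of_exponent_le (by linarith) (by norm_num)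
  have e2 : y ^ (2 : ℝ)⁻¹ = √y := by rw [Real.sqrt_eq_rpow]; norm_num
  have e3 : 4 * y ^ (3 : ℝ)⁻¹ ≤ √y := by
    have h6 : (4 : ℝ) ≤ y ^ (6 : ℝ)⁻¹ := by
      rw [Real.le_rpow_inv_iff_of_pos (by norm_num) hy0 (by norm_num)]
      norm_num
      linarith
    have : √y = y ^ (6 : ℝ)⁻¹ * y ^ (3 : ℝ)⁻¹ := by
      rw [← Real.rpow_add (by linarith), Real.sqrt_eq_rpow]; norm_num
    rw [this]
    gcongr
  rw [e2] at h h2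
  linarith [Real.sqrt_nonneg y]

theorem theta_two_mul_sub_theta_le {x : ℝ} (hx : 0 ≤ x) :
    Chebyshev.theta (2 * x) - Chebyshev.theta x ≤
      ((Finset.Icc ⌈x⌉₊ ⌊2 * x⌋₊).filter Nat.Prime).card * Real.log (2 * x) := by
  have hle : ⌊x⌋₊ ≤ ⌊2 * x⌋₊ := Nat.floor_le_floor (by linarith)
  have hsub : Finset.Ioc ⌊x⌋₊ ⌊2 * x⌋₊ ⊆ Finset.Icc ⌈x⌉₊ ⌊2 * x⌋₊ := fun p hp ↦ by
    simp only [Finset.mem_Ioc, Finset.mem_Icc] at hp ⊢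
    exact ⟨(Nat.ceil_le_floor_add_one x).trans hp.1, hp.2⟩
  rw [Chebyshev.theta, Chebyshev.theta, Finset.sum_filter, Finset.sum_filter,
    ← Finset.sum_Ioc_consecutive _ (Nat.zero_le _) hle, add_sub_cancel_left, ← Finset.sum_filter,
    ← nsmul_eq_mul]
  refine (Finset.sum_le_sum_of_subset_of_nonneg (Finset.filter_subset_filter _ hsub)
    fun p _ _ ↦ Real.log_natCast_nonneg p).trans (Finset.sum_le_card_nsmul _ _ _ fun p hp ↦ ?_)
  simp only [Finset.mem_filter, Finset.mem_Icc] at hp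
  exact Real.log_le_log (by exact_mod_cast hp.2.pos)
    ((Nat.le_floor_iff (by linarith)).mp hp.1.2)

theorem prime_count_of_five_thousand_le {x : ℝ} (hx : 5000 ≤ x) :
    (3 / 5) * x / Real.log x ≤
      (((Finset.Icc ⌈x⌉₊ ⌊2 * x⌋₊).filter Nat.Prime).card : ℝ) := by
  have hcard := theta_two_mul_sub_theta_le (x := x) (by linarith)
  have hlow := psi_ge_of_thirty_le (x := 2 * x) (by linarith)
  have hup := psi_le_add_psi_div_six (x := x) (by linarith)
  have hup6 := psi_le_add_psi_div_six (x := x / 6) (by linarith)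
  have hup36 := psi_le_of_nonneg (x := x / 6 / 6) (by linarith)
  have hpow := psi_sub_theta_le_of_le (y := 2 * x) (by linarith)
  have hth := Chebyshev.theta_le_psi x
  have hlog5000 : Real.log 5000 = 3 * Real.log 2 + 4 * Real.log 5 := by
    rw [show (5000 : ℝ) = 2 ^ 3 * 5 ^ 4 by norm_num,
      Real.log_mul (by norm_num) (by norm_num), Real.log_pow, Real.log_pow]
    norm_num
  have hlogge : Real.log 5000 ≤ Real.log x := Real.log_le_log (by norm_num) hx
  have hlogle : Real.log (x / 5000) ≤ x / 5000 - 1 := Real.log_le_sub_one_of_pos (by positivity)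
  have hl6 : Real.log (x / 6) ≤ Real.log x := Real.log_le_log (by linarith) (by linarith)
  have hsqrt : 200 * √(2 * x) ≤ 2 * x + 10000 := by
    nlinarith [sq_nonneg (√(2 * x) - 100), Real.sq_sqrt (by linarith : 0 ≤ 2 * x)]
  have hlog2 : Real.log (2 * x) = Real.log 2 + Real.log x :=
    Real.log_mul (by norm_num) (by linarith)
  rw [Real.log_div (by positivity) (by norm_num)] at hlogle
  have b2 := Real.log_two_lt_d9
  have b2' := Real.log_two_gt_d9
  have b5 := Real.log_five_lt_d9
  have b5' := Real.log_five_gt_d9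
  rw [hlog2] at hcard hlow
  set c := (((Finset.Icc ⌈x⌉₊ ⌊2 * x⌋₊).filter Nat.Prime).card : ℝ)
  have hlogx : (17 / 2 : ℝ) ≤ Real.log x := by linarith
  have hmain : 65 / 100 * x ≤ c * (Real.log 2 + Real.log x) := by linarith
  have hlog : Real.log 2 + Real.log x ≤ 13 / 12 * Real.log x := by linarith
  have hc : 0 ≤ c := Nat.cast_nonneg _
  rw [div_le_iff₀ (by linarith)]
  have := mul_le_mul_of_nonneg_left hlog hc
  linarith

/-- Rosser–Schoenfeld: for every real `λ ≥ 21`, the number of primes `p`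
with `λ ≤ p ≤ 2λ` is at least `(3/5)·λ/ln λ`. -/
theorem rosser_schoenfeld (lam : ℝ) (hlam : 21 ≤ lam) :
    (3 / 5) * lam / Real.log lam ≤
      (((Finset.Icc ⌈lam⌉₊ ⌊2 * lam⌋₊).filter Nat.Prime).card : ℝ) := by
  rcases lt_or_ge lam 5000 with h | h
  · exact prime_count_of_lt_five_thousand hlam h
  · exact prime_count_of_five_thousand_le h
end

section
/- Let n be a positive integer, u and v two distinct vectors in ℕⁿ, S a finite nonempty set of natural numbers, and let s = (s₁, …, sₙ) be chosen uniformly at random in Sⁿ. Then the probability that Σ_{i=1}^{n} u_i·s_i = Σ_{i=1}^{n} v_i·s_i is at most 1/|S|. -/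
/-- Two solutions of `u·s = v·s` that agree off a coordinate where `u` and `v` differ are equal. -/
theorem eq_of_dot_eq_of_eq_off {ι : Type*} [Fintype ι] {u v s t : ι → ℕ} {j : ι}
    (hj : u j ≠ v j) (hs : ∑ i, u i * s i = ∑ i, v i * s i)
    (ht : ∑ i, u i * t i = ∑ i, v i * t i) (hst : ∀ i, i ≠ j → s i = t i) : s = t := by
  have hsum : ∑ i, ((u i : ℤ) - v i) * ((s i : ℤ) - t i) = 0 := by
    zify at hs ht
    simp only [sub_mul, mul_sub, Finset.sum_sub_distrib]
    linarith
  rw [Finset.sum_eq_single j (fun i _ hi => by simp [hst i hi]) (by simp)] at hsum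
  funext i
  by_cases hi : i = j
  · subst hi
    rcases mul_eq_zero.mp hsum with h | h <;> omega
  · exact hst i hi

/-- The number of solutions of `u·s = v·s` in `Sⁿ`, times `|S|`, is at most `|Sⁿ|`. -/
theorem card_dot_eq_mul_card_le {ι : Type*} [Fintype ι] [DecidableEq ι] {u v : ι → ℕ}
    (huv : u ≠ v) (S : Finset ℕ) :
    ((Fintype.piFinset (fun _ : ι => S)).filter
        (fun s => ∑ i, u i * s i = ∑ i, v i * s i)).card * S.card ≤
      (Fintype.piFinset (fun _ : ι => S)).card := by
  obtain ⟨j, hj⟩ := Function.ne_iff.mp huv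
  rw [← Finset.card_product]
  refine Finset.card_le_card_of_injOn (fun p => Function.update p.1 j p.2) ?_ ?_
  · rintro ⟨s, a⟩ h
    simp only [Finset.coe_product, Set.mem_prod, Finset.mem_coe, Finset.mem_filter,
      Fintype.mem_piFinset] at h ⊢
    intro i
    by_cases hi : i = j
    · subst hi
      simpa using h.2
    · simpa [hi] using h.1.1 i
  · rintro ⟨s, a⟩ hs ⟨t, b⟩ ht h
    simp only [Finset.coe_product, Set.mem_prod, Finset.mem_coe, Finset.mem_filter] at hs ht
    have hab : a = b := by simpa using congrFun h j
    have hst : s = t := eq_of_dot_eq_of_eq_off hj hs.1.2 ht.1.2 fun i hi => by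
      simpa [hi] using congrFun h i
    rw [hab, hst]

/-- For distinct vectors `u ≠ v` in `ℕⁿ` and `s` uniform in `Sⁿ`, the
probability that `u·s = v·s` is at most `1/|S|`. -/
theorem dot_product_collision_prob (n : ℕ) (hn : 0 < n) (u v : Fin n → ℕ)
    (huv : u ≠ v) (S : Finset ℕ) (hS : S.Nonempty) :
    ((((Fintype.piFinset (fun _ : Fin n => S)).filter
          (fun s => ∑ i, u i * s i = ∑ i, v i * s i)).card : ℝ) /
        ((Fintype.piFinset (fun _ : Fin n => S)).card : ℝ)) ≤ 1 / S.card := by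
  have hpi : (Fintype.piFinset (fun _ : Fin n => S)).Nonempty :=
    Fintype.piFinset_nonempty.mpr fun _ => hS
  rw [div_le_div_iff₀ (by exact_mod_cast hpi.card_pos) (by exact_mod_cast hS.card_pos), one_mul]
  exact_mod_cast card_dot_eq_mul_card_le huv S
end
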